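/- (Corollary, Section 4.3, self-decomposability for the stable-case power series.) Let 1 < ρ < 2, α > 0 and γ ≥ 0. Then there exist a ≥ 0 and a nonincreasing function k : (0,∞) → [0,∞) with ∫₀^∞ min(1,r)·(k(r)/r) dr < ∞ such that for all q ≥ 0: 1 / I_{α,γ,ρ}(q) = exp( −( a·q + ∫₀^∞ (1 − e^{−q·r})·(k(r)/r) dr ) ). In other words, q ↦ 1/I_{α,γ,ρ}(q) is the Laplace transform of a self-decomposable probability distribution on [0,∞). -/

import Mathlib

open MeasureTheory Real Set Filter Topology

/-- The generalized factorial symbol `(α,γ)_{ρ,n} = ∏_{k=1}^n ((kα+γ)^ρ - γ^ρ)`. -/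
noncomputable def genFactorial (α γ ρ : ℝ) (n : ℕ) : ℝ :=
  ∏ k ∈ Finset.range n, (((k + 1 : ℕ) * α + γ) ^ ρ - γ ^ ρ)

/-- The entire function `I_{α,γ,ρ}(x) = Σ_{n≥0} x^n / (α,γ)_{ρ,n}` associated with the
spectrally negative stable Laplace exponent. -/
noncomputable def IstableSer (α γ ρ : ℝ) (x : ℝ) : ℝ :=
  ∑' n : ℕ, x ^ n / genFactorial α γ ρ n

section LaplaceTransforms

open scoped NNReal ENNReal

theorem Ring.choose_succ_real (ρ : ℝ) (n : ℕ) :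
    Ring.choose ρ (n + 1) = Ring.choose ρ n * ((ρ - n) / (n + 1)) := by
  simp only [Ring.choose_eq_smul, descPochhammer_succ_right, Polynomial.smeval_mul,
    Polynomial.smeval_sub, Polynomial.smeval_X, Polynomial.smeval_natCast, smul_eq_mul,
    Nat.factorial_succ]
  have : ((n.factorial : ℕ) : ℝ) ≠ 0 := by positivity
  push_cast
  field_simp
  simp

theorem exists_hasSum_one_sub_rpow {ρ : ℝ} (h1 : 1 < ρ) (h2 : ρ < 2) :
    ∃ c : ℕ → ℝ, (∀ k, 0 ≤ c k) ∧ Summable c ∧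
      ∀ z ∈ Icc (0 : ℝ) 1, (1 - z) ^ ρ = 1 - ρ * z + ∑' k, c k * z ^ (k + 2) := by
  set a : ℕ → ℝ := fun n => (-1) ^ n * Ring.choose ρ n with ha
  have hrec : ∀ n, a (n + 1) = a n * ((n - ρ) / (n + 1)) := by
    intro n
    simp only [ha, Ring.choose_succ_real, pow_succ]
    ring
  have ha0 : a 0 = 1 := by simp [ha]
  have ha1 : a 1 = -ρ := by simpa [ha0] using hrec 0
  have hpos : ∀ k, 0 ≤ a (k + 2) := by
    intro k
    induction k with
    | zero =>
      have := hrec 1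
      rw [ha1] at this
      norm_num at this ⊢
      rw [this]
      nlinarith
    | succ k ih =>
      rw [hrec (k + 2)]
      refine mul_nonneg ih (div_nonneg ?_ (by positivity))
      push_cast
      have : (0 : ℝ) ≤ k := k.cast_nonneg
      linarith
  have hlt : ∀ z ∈ Ico (0 : ℝ) 1,
      HasSum (fun k => a (k + 2) * z ^ (k + 2)) ((1 - z) ^ ρ - (1 - ρ * z)) := by
    intro z hz
    have hs := (Real.one_add_rpow_hasFPowerSeriesOnBall_zero (a := ρ)).hasSum (y := -z)
      (by simpa [enorm_eq_nnnorm, ← NNReal.coe_lt_one, abs_of_nonneg hz.1] using hz.2)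
    have hs' : HasSum (fun n => a n * z ^ n) ((1 - z) ^ ρ) := by
      rw [zero_add, ← sub_eq_add_neg] at hs
      refine hs.congr_fun fun n => ?_
      rw [binomialSeries_apply]
      simp [ha, neg_pow z n]
      ring
    have := (hasSum_nat_add_iff' 2).2 hs'
    simpa [Finset.sum_range_succ, ha0, ha1, ← sub_eq_add_neg] using this
  have hcont : ContinuousOn (fun z : ℝ => (1 - z) ^ ρ - (1 - ρ * z)) (Icc 0 1) := by
    apply Continuous.continuousOn
    have : Continuous fun z : ℝ => (1 - z) ^ ρ :=
      (continuous_const.sub continuous_id).rpow_const (fun x => Or.inr (by linarith))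
    fun_prop
  have hcl : Icc (0:ℝ) 1 ⊆ closure (Ico (0 : ℝ) 1) := by
    rw [closure_Ico (by norm_num)]
  have hsum : Summable fun k => a (k + 2) := by
    refine summable_of_sum_le hpos (c := ρ - 1) fun u => ?_
    have hc : ContinuousOn (fun z : ℝ => ∑ k ∈ u, a (k + 2) * z ^ (k + 2)) (Icc 0 1) := by fun_prop
    have := le_on_closure (s := Ico (0 : ℝ) 1)
      (f := fun z : ℝ => ∑ k ∈ u, a (k + 2) * z ^ (k + 2))
      (g := fun z : ℝ => (1 - z) ^ ρ - (1 - ρ * z))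
      (fun z hz => by
        rw [← (hlt z hz).tsum_eq]
        exact (hlt z hz).summable.sum_le_tsum u fun k _ =>
          mul_nonneg (hpos k) (pow_nonneg hz.1 _))
      (by rwa [closure_Ico (by norm_num)]) (by rwa [closure_Ico (by norm_num)])
      (hcl ⟨zero_le_one, le_rfl⟩)
    have h0 : (0 : ℝ) ^ ρ = 0 := Real.zero_rpow (by linarith)
    simp [h0] at this
    linarith
  refine ⟨fun k => a (k + 2), hpos, hsum, fun z hz => ?_⟩
  have hc2 : ContinuousOn (fun z : ℝ => ∑' k, a (k + 2) * z ^ (k + 2)) (Icc 0 1) := by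
    refine continuousOn_tsum (fun k => by fun_prop) hsum fun k x hx => ?_
    rw [norm_mul, Real.norm_of_nonneg (hpos k), Real.norm_of_nonneg (pow_nonneg hx.1 _)]
    exact mul_le_of_le_one_right (hpos k) (pow_le_one₀ hx.1 hx.2)
  have : EqOn (fun z : ℝ => (1 - z) ^ ρ - (1 - ρ * z))
      (fun z : ℝ => ∑' k, a (k + 2) * z ^ (k + 2)) (Icc 0 1) :=
    EqOn.of_subset_closure (fun z hz => (hlt z hz).tsum_eq.symm) hcont hc2 Ico_subset_Icc_self hcl
  have := this hz
  simp only at this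
  linarith

/-- `f` agrees on `[0,∞)` with the Laplace transform of a (finite) measure on `[0,∞)`. -/
def IsLaplaceTransform (f : ℝ → ℝ) : Prop :=
  ∃ μ : Measure ℝ≥0, ∀ x : ℝ, 0 ≤ x →
    0 ≤ f x ∧ ∫⁻ r, ENNReal.ofReal (exp (-(x * r))) ∂μ = ENNReal.ofReal (f x)

namespace IsLaplaceTransform

theorem nonneg {f : ℝ → ℝ} (hf : IsLaplaceTransform f) {x : ℝ} (hx : 0 ≤ x) : 0 ≤ f x := by
  obtain ⟨μ, hμ⟩ := hf
  exact (hμ x hx).1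

theorem measure_univ_eq {f : ℝ → ℝ} {μ : Measure ℝ≥0}
    (hμ : ∀ x : ℝ, 0 ≤ x →
      0 ≤ f x ∧ ∫⁻ r, ENNReal.ofReal (exp (-(x * r))) ∂μ = ENNReal.ofReal (f x)) :
    μ univ = ENNReal.ofReal (f 0) := by
  simpa using (hμ 0 le_rfl).2

theorem isFiniteMeasure {f : ℝ → ℝ} {μ : Measure ℝ≥0}
    (hμ : ∀ x : ℝ, 0 ≤ x →
      0 ≤ f x ∧ ∫⁻ r, ENNReal.ofReal (exp (-(x * r))) ∂μ = ENNReal.ofReal (f x)) :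
    IsFiniteMeasure μ :=
  ⟨by rw [measure_univ_eq hμ]; exact ENNReal.ofReal_lt_top⟩

theorem one : IsLaplaceTransform fun _ => 1 :=
  ⟨Measure.dirac 0, fun x _ => ⟨zero_le_one, by
    rw [lintegral_dirac]; simp⟩⟩

theorem comp_mul {f : ℝ → ℝ} (hf : IsLaplaceTransform f) {b : ℝ} (hb : 0 ≤ b) :
    IsLaplaceTransform fun x => f (b * x) := by
  obtain ⟨μ, hμ⟩ := hf
  lift b to ℝ≥0 using hb
  refine ⟨μ.map fun r => b * r, fun x hx => ⟨(hμ _ (by positivity)).1, ?_⟩⟩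
  rw [lintegral_map (by fun_prop) (by fun_prop), ← (hμ _ (by positivity)).2]
  refine lintegral_congr fun r => ?_
  congr 3
  push_cast
  ring

theorem mul {f g : ℝ → ℝ} (hf : IsLaplaceTransform f) (hg : IsLaplaceTransform g) :
    IsLaplaceTransform fun x => f x * g x := by
  obtain ⟨μ, hμ⟩ := hf
  obtain ⟨ν, hν⟩ := hg
  have := isFiniteMeasure hμ
  have := isFiniteMeasure hν
  refine ⟨Measure.conv μ ν, fun x hx => ⟨mul_nonneg (hμ x hx).1 (hν x hx).1, ?_⟩⟩
  rw [Measure.lintegral_conv (by fun_prop), ENNReal.ofReal_mul (hμ x hx).1, ← (hμ x hx).2,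
    ← (hν x hx).2, ← lintegral_mul_const _ (by fun_prop)]
  refine lintegral_congr fun r => ?_
  rw [← lintegral_const_mul _ (by fun_prop)]
  refine lintegral_congr fun s => ?_
  rw [← ENNReal.ofReal_mul (exp_nonneg _), ← Real.exp_add]
  congr 2
  push_cast
  ring

theorem const_mul {f : ℝ → ℝ} (hf : IsLaplaceTransform f) {c : ℝ} (hc : 0 ≤ c) :
    IsLaplaceTransform fun x => c * f x := by
  obtain ⟨μ, hμ⟩ := hf
  refine ⟨ENNReal.ofReal c • μ, fun x hx => ⟨mul_nonneg hc (hμ x hx).1, ?_⟩⟩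
  rw [lintegral_smul_measure, (hμ x hx).2, ENNReal.ofReal_mul hc, smul_eq_mul]

theorem hasSum {f : ℕ → ℝ → ℝ} {g : ℝ → ℝ} (hf : ∀ n, IsLaplaceTransform (f n))
    (h : ∀ x, 0 ≤ x → HasSum (fun n => f n x) (g x)) : IsLaplaceTransform g := by
  choose μ hμ using hf
  refine ⟨Measure.sum μ, fun x hx => ⟨(h x hx).nonneg fun n => (hμ n x hx).1, ?_⟩⟩
  rw [lintegral_sum_measure, ← (h x hx).tsum_eq,
    ENNReal.ofReal_tsum_of_nonneg (fun n => (hμ n x hx).1) (h x hx).summable]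
  exact tsum_congr fun n => (hμ n x hx).2

theorem prod {ι : Type*} {f : ι → ℝ → ℝ} (s : Finset ι) (hf : ∀ i ∈ s, IsLaplaceTransform (f i)) :
    IsLaplaceTransform fun x => ∏ i ∈ s, f i x := by
  classical
  induction s using Finset.induction_on with
  | empty => simpa using one
  | insert i s hi ih =>
    simp only [Finset.prod_insert hi]
    exact (hf i (Finset.mem_insert_self i s)).mul
      (ih fun j hj => hf j (Finset.mem_insert_of_mem hj))

theorem pow {f : ℝ → ℝ} (hf : IsLaplaceTransform f) (n : ℕ) :
    IsLaplaceTransform fun x => f x ^ n := by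
  simpa using prod (Finset.range n) fun _ _ => hf

theorem inv_add_mul {s b : ℝ} (hs : 0 < s) (hb : 0 ≤ b) :
    IsLaplaceTransform fun x => (s + b * x)⁻¹ := by
  refine ⟨((volume.restrict (Ioi (0 : ℝ))).withDensity
    fun t => ENNReal.ofReal (exp (-(s * t)))).map fun t => (b * t).toNNReal, fun x hx =>
    ⟨by positivity, ?_⟩⟩
  have hsx : 0 < s + b * x := by positivity
  rw [lintegral_map (by fun_prop) (by fun_prop),
    lintegral_withDensity_eq_lintegral_mul _ (by fun_prop) (by fun_prop)]
  have h1 := integral_exp_mul_Ioi (a := -(s + b * x)) (by linarith) 0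
  have h2 := integrableOn_exp_mul_Ioi (a := -(s + b * x)) (by linarith) 0
  rw [mul_zero, Real.exp_zero, neg_div_neg_eq, one_div] at h1
  simp only [← h1]
  rw [ofReal_integral_eq_lintegral_ofReal h2 (ae_of_all _ fun t => exp_nonneg _)]
  refine setLIntegral_congr_fun measurableSet_Ioi fun t (ht : 0 < t) => ?_
  simp only [Pi.mul_apply]
  rw [← ENNReal.ofReal_mul (exp_nonneg _), ← Real.exp_add, Real.coe_toNNReal _ (by positivity)]
  congr 2
  ring

/-- The one-step first-passage functional of an upward skip-free chain. -/
theorem firstPassage {g : ℝ → ℝ} (hg : IsLaplaceTransform g) (hg1 : ∀ x, 0 ≤ x → g x ≤ 1)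
    {p : ℕ → ℝ} (hp : ∀ k, 0 ≤ p k) (hps : Summable p) {w b : ℝ} (hw : 0 < w) (hb : 0 ≤ b) :
    IsLaplaceTransform fun x => w / (w + (b * x +
      ∑' k, p k * (1 - ∏ i ∈ Finset.range (k + 1), g (b ^ (i + 1) * x)))) := by
  set P : ℝ → ℝ := fun x => ∑' k, p k * ∏ i ∈ Finset.range (k + 1), g (b ^ (i + 1) * x) with hP
  have hprod0 : ∀ k x, 0 ≤ x → 0 ≤ ∏ i ∈ Finset.range (k + 1), g (b ^ (i + 1) * x) :=
    fun k x hx => Finset.prod_nonneg fun i _ => hg.nonneg (by positivity)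
  have hprod1 : ∀ k x, 0 ≤ x → ∏ i ∈ Finset.range (k + 1), g (b ^ (i + 1) * x) ≤ 1 :=
    fun k x hx => Finset.prod_le_one (fun i _ => hg.nonneg (by positivity))
      fun i _ => hg1 _ (by positivity)
  have hsum : ∀ x, 0 ≤ x →
      Summable fun k => p k * ∏ i ∈ Finset.range (k + 1), g (b ^ (i + 1) * x) := fun x hx =>
    hps.of_nonneg_of_le (fun k => mul_nonneg (hp k) (hprod0 k x hx))
      fun k => mul_le_of_le_one_right (hp k) (hprod1 k x hx)
  have hPlap : IsLaplaceTransform P := by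
    refine hasSum (fun k => const_mul (prod (Finset.range (k + 1)) fun i _ =>
      hg.comp_mul (pow_nonneg hb (i + 1))) (hp k)) fun x hx => (hsum x hx).hasSum
  have hPle : ∀ x, 0 ≤ x → P x ≤ ∑' k, p k := fun x hx =>
    (hsum x hx).tsum_le_tsum (fun k => mul_le_of_le_one_right (hp k) (hprod1 k x hx)) hps
  have hS : 0 ≤ ∑' k, p k := tsum_nonneg hp
  have hinv : IsLaplaceTransform fun x => ((w + ∑' k, p k) + b * x)⁻¹ :=
    inv_add_mul (by positivity) hb
  refine hasSum (fun n => const_mul (hinv.mul ((hPlap.mul hinv).pow n)) hw.le) fun x hx => ?_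
  have hD : 0 < w + ∑' k, p k + b * x := by positivity
  have hlt : P x < w + ∑' k, p k + b * x := by
    have := hPle x hx
    nlinarith [mul_nonneg hb hx]
  have hgeo := ((hasSum_geometric_of_lt_one (r := P x * (w + ∑' k, p k + b * x)⁻¹)
    (mul_nonneg (hPlap.nonneg hx) (by positivity))
    (by rw [← div_eq_mul_inv, div_lt_one hD]; exact hlt)).mul_left
      ((w + ∑' k, p k + b * x)⁻¹)).mul_left w
  have hdiff : ∑' k, p k * (1 - ∏ i ∈ Finset.range (k + 1), g (b ^ (i + 1) * x)) =
      ∑' k, p k - P x := by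
    rw [hP, ← hps.tsum_sub (hsum x hx)]
    exact tsum_congr fun k => by ring
  have hval : w / (w + (b * x + (∑' k, p k - P x))) = w * ((w + ∑' k, p k + b * x)⁻¹ *
      (1 - P x * (w + ∑' k, p k + b * x)⁻¹)⁻¹) := by
    rw [← mul_inv, div_eq_mul_inv]
    congr 2
    field_simp
    ring
  rw [hdiff, hval]
  exact hgeo

end IsLaplaceTransform

section SkipFree

/-- One step of the first-passage recursion of an upward skip-free chain on a geometric grid. -/
noncomputable def firstPassageStep (w b : ℝ) (p : ℕ → ℝ) (g : ℝ → ℝ) (x : ℝ) : ℝ :=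
  w / (w + (b * x + ∑' k, p k * (1 - ∏ i ∈ Finset.range (k + 1), g (b ^ (i + 1) * x))))

theorem abs_prod_sub_prod_le {ι : Type*} (s : Finset ι) (f g : ι → ℝ)
    (hf : ∀ i ∈ s, f i ∈ Icc (0 : ℝ) 1) (hg : ∀ i ∈ s, g i ∈ Icc (0 : ℝ) 1) :
    |∏ i ∈ s, f i - ∏ i ∈ s, g i| ≤ ∑ i ∈ s, |f i - g i| := by
  classical
  induction s using Finset.induction_on with
  | empty => simp
  | insert i s hi ih =>
    rw [Finset.prod_insert hi, Finset.prod_insert hi, Finset.sum_insert hi]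
    have ih' := ih (fun j hj => hf j (Finset.mem_insert_of_mem hj))
      fun j hj => hg j (Finset.mem_insert_of_mem hj)
    have hfi := hf i (Finset.mem_insert_self i s)
    have h0 : 0 ≤ ∏ j ∈ s, g j :=
      Finset.prod_nonneg fun j hj => (hg j (Finset.mem_insert_of_mem hj)).1
    have h1 : ∏ j ∈ s, g j ≤ 1 :=
      Finset.prod_le_one (fun j hj => (hg j (Finset.mem_insert_of_mem hj)).1)
        fun j hj => (hg j (Finset.mem_insert_of_mem hj)).2
    calc |f i * ∏ j ∈ s, f j - g i * ∏ j ∈ s, g j|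
        = |f i * (∏ j ∈ s, f j - ∏ j ∈ s, g j) + (f i - g i) * ∏ j ∈ s, g j| := by
          congr 1; ring
      _ ≤ |f i * (∏ j ∈ s, f j - ∏ j ∈ s, g j)| + |(f i - g i) * ∏ j ∈ s, g j| := abs_add_le _ _
      _ ≤ |f i - g i| + ∑ j ∈ s, |f j - g j| := by
          rw [abs_mul, abs_mul, abs_of_nonneg hfi.1, abs_of_nonneg h0, add_comm]
          exact add_le_add (mul_le_of_le_one_right (abs_nonneg _) h1)
            ((mul_le_of_le_one_left (abs_nonneg _) hfi.2).trans ih')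

variable {w b : ℝ} {p : ℕ → ℝ}

theorem prod_geom_mem_Icc {g : ℝ → ℝ} (hb : 0 ≤ b) (hg : ∀ x, 0 ≤ x → g x ∈ Icc (0 : ℝ) 1)
    {x : ℝ} (hx : 0 ≤ x) (k : ℕ) :
    ∏ i ∈ Finset.range k, g (b ^ (i + 1) * x) ∈ Icc (0 : ℝ) 1 :=
  ⟨Finset.prod_nonneg fun i _ => (hg _ (by positivity)).1,
    Finset.prod_le_one (fun i _ => (hg _ (by positivity)).1) fun i _ => (hg _ (by positivity)).2⟩

theorem summable_mul_one_sub_prod {g : ℝ → ℝ} (hb : 0 ≤ b) (hp : ∀ k, 0 ≤ p k) (hps : Summable p)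
    (hg : ∀ x, 0 ≤ x → g x ∈ Icc (0 : ℝ) 1) {x : ℝ} (hx : 0 ≤ x) :
    Summable fun k => p k * (1 - ∏ i ∈ Finset.range (k + 1), g (b ^ (i + 1) * x)) := by
  refine hps.of_nonneg_of_le (fun k => mul_nonneg (hp k) ?_) fun k =>
    mul_le_of_le_one_right (hp k) ?_
  · linarith [(prod_geom_mem_Icc hb hg hx (k + 1)).2]
  · linarith [(prod_geom_mem_Icc hb hg hx (k + 1)).1]

theorem firstPassage_denom_nonneg {g : ℝ → ℝ} (hb : 0 ≤ b) (hp : ∀ k, 0 ≤ p k)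
    (hg : ∀ x, 0 ≤ x → g x ∈ Icc (0 : ℝ) 1) {x : ℝ} (hx : 0 ≤ x) :
    0 ≤ b * x + ∑' k, p k * (1 - ∏ i ∈ Finset.range (k + 1), g (b ^ (i + 1) * x)) := by
  refine add_nonneg (by positivity) (tsum_nonneg fun k => mul_nonneg (hp k) ?_)
  linarith [(prod_geom_mem_Icc hb hg hx (k + 1)).2]

theorem firstPassageStep_mem_Icc {g : ℝ → ℝ} (hw : 0 < w) (hb : 0 ≤ b) (hp : ∀ k, 0 ≤ p k)
    (hg : ∀ x, 0 ≤ x → g x ∈ Icc (0 : ℝ) 1) {x : ℝ} (hx : 0 ≤ x) :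
    firstPassageStep w b p g x ∈ Icc (0 : ℝ) 1 := by
  have h := firstPassage_denom_nonneg hb hp hg hx
  rw [firstPassageStep]
  exact ⟨by positivity, div_le_one_of_le₀ (by linarith) (by linarith)⟩

theorem firstPassageStep_zero {g : ℝ → ℝ} (hw : 0 < w) (hg : g 0 = 1) :
    firstPassageStep w b p g 0 = 1 := by
  simp [firstPassageStep, hg, hw.ne']

theorem abs_div_add_sub_div_add_le {w A B : ℝ} (hw : 0 < w) (hA : 0 ≤ A) (hB : 0 ≤ B) :
    |w / (w + A) - w / (w + B)| ≤ |A - B| / w := by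
  have h : w / (w + A) - w / (w + B) = (B - A) * (w / ((w + A) * (w + B))) := by
    field_simp
    ring
  rw [h, abs_mul, abs_sub_comm, div_eq_mul_inv |A - B|,
    abs_of_nonneg (a := w / ((w + A) * (w + B))) (by positivity)]
  refine mul_le_mul_of_nonneg_left ?_ (abs_nonneg _)
  rw [div_le_iff₀ (by positivity), inv_mul_eq_div, le_div_iff₀ hw]
  nlinarith [mul_nonneg hA hB, mul_nonneg hA hw.le, mul_nonneg hB hw.le]

theorem abs_firstPassageStep_sub_le {g g' : ℝ → ℝ} (hw : 0 < w) (hb : 0 < b) (hb1 : b < 1)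
    (hp : ∀ k, 0 ≤ p k) (hps : Summable p)
    (hg : ∀ x, 0 ≤ x → g x ∈ Icc (0 : ℝ) 1) (hg' : ∀ x, 0 ≤ x → g' x ∈ Icc (0 : ℝ) 1)
    {C M : ℝ} (h : ∀ x ∈ Icc 0 M, |g x - g' x| ≤ C * x) {x : ℝ} (hx : x ∈ Icc 0 M) :
    |firstPassageStep w b p g x - firstPassageStep w b p g' x| ≤
      C * ((∑' k, p k * (1 - b ^ (k + 1))) * (b / (1 - b)) / w) * x := by
  have hb1' : 0 < 1 - b := by linarith
  have hsp : Summable fun k => p k * (1 - b ^ (k + 1)) :=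
    hps.of_nonneg_of_le (fun k => mul_nonneg (hp k)
      (by linarith [pow_le_one₀ (n := k + 1) hb.le hb1.le]))
      fun k => mul_le_of_le_one_right (hp k) (by linarith [pow_pos hb (k + 1)])
  refine (abs_div_add_sub_div_add_le hw (firstPassage_denom_nonneg hb.le hp hg hx.1)
    (firstPassage_denom_nonneg hb.le hp hg' hx.1)).trans ?_
  have hkey : ∀ k, |p k * (1 - ∏ i ∈ Finset.range (k + 1), g (b ^ (i + 1) * x)) -
      p k * (1 - ∏ i ∈ Finset.range (k + 1), g' (b ^ (i + 1) * x))| ≤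
      p k * (1 - b ^ (k + 1)) * (C * x * (b / (1 - b))) := by
    intro k
    rw [← mul_sub, abs_mul, abs_of_nonneg (hp k), mul_assoc]
    refine mul_le_mul_of_nonneg_left ?_ (hp k)
    rw [sub_sub_sub_cancel_left, abs_sub_comm]
    refine (abs_prod_sub_prod_le _ _ _ (fun i _ => hg _ (by have := hx.1; positivity))
      fun i _ => hg' _ (by have := hx.1; positivity)).trans ?_
    calc ∑ i ∈ Finset.range (k + 1), |g (b ^ (i + 1) * x) - g' (b ^ (i + 1) * x)|
        ≤ ∑ i ∈ Finset.range (k + 1), C * (b ^ (i + 1) * x) := by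
          refine Finset.sum_le_sum fun i _ => h _ ⟨by have := hx.1; positivity, ?_⟩
          exact (mul_le_of_le_one_left hx.1 (pow_le_one₀ hb.le hb1.le)).trans hx.2
      _ = (C * x * b) * ∑ i ∈ Finset.range (k + 1), b ^ i := by
          rw [Finset.mul_sum]
          exact Finset.sum_congr rfl fun i _ => by ring
      _ = (1 - b ^ (k + 1)) * (C * x * (b / (1 - b))) := by
          rw [geom_sum_eq hb1.ne, ← neg_sub 1 b, ← neg_sub 1 (b ^ (k + 1))]
          field_simp
  rw [add_sub_add_left_eq_sub, ← (summable_mul_one_sub_prod hb.le hp hps hg hx.1).tsum_sub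
    (summable_mul_one_sub_prod hb.le hp hps hg' hx.1)]
  have := tsum_of_norm_bounded (f := fun k =>
    p k * (1 - ∏ i ∈ Finset.range (k + 1), g (b ^ (i + 1) * x)) -
      p k * (1 - ∏ i ∈ Finset.range (k + 1), g' (b ^ (i + 1) * x)))
    (hsp.hasSum.mul_right (C * x * (b / (1 - b)))) hkey
  rw [Real.norm_eq_abs] at this
  calc _ ≤ _ := div_le_div_of_nonneg_right this hw.le
    _ = _ := by ring

variable {c : ℕ → ℝ}

theorem tsum_pow_div_eigen (hb : 0 < b) (hb1 : b < 1) (hp : ∀ k, 0 ≤ p k)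
    (hps : Summable p) (hc : ∀ n, 0 < c n) (hs : ∀ x : ℝ, Summable fun n => x ^ n / c n)
    (hrec : ∀ n, c (n + 1) =
      (w * ((b ^ (n + 1))⁻¹ - 1) - ∑' k, p k * (1 - (b ^ (k + 1)) ^ (n + 1))) * c n)
    {x : ℝ} (hx : 0 ≤ x) :
    w * (∑' n, x ^ n / c n - ∑' n, (b * x) ^ n / c n) = b * x * ∑' n, (b * x) ^ n / c n +
      ∑' k, p k * (∑' n, (b * x) ^ n / c n - ∑' n, (b ^ (k + 1) * (b * x)) ^ n / c n) := by
  have hle : ∀ k n, (b ^ (k + 1)) ^ n ≤ 1 := fun k n => pow_le_one₀ (by positivity)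
    (pow_le_one₀ hb.le hb1.le)
  have hF : Summable fun q : ℕ × ℕ =>
      p q.1 * ((b * x) ^ q.2 / c q.2 * (1 - (b ^ (q.1 + 1)) ^ q.2)) := by
    refine (hps.mul_of_nonneg (hs (b * x)) hp fun n => by have := hc n; positivity).of_nonneg_of_le
      (fun q => ?_) fun q => ?_
    · have := hc q.2
      have := hp q.1
      have := sub_nonneg.2 (hle q.1 q.2)
      positivity
    · have := hc q.2
      refine mul_le_mul_of_nonneg_left (mul_le_of_le_one_right (by positivity) ?_) (hp q.1)
      have : 0 < (b ^ (q.1 + 1)) ^ q.2 := by positivity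
      linarith
  have h3 : ∑' k, p k * (∑' n, (b * x) ^ n / c n - ∑' n, (b ^ (k + 1) * (b * x)) ^ n / c n) =
      ∑' n, (b * x) ^ n / c n * ∑' k, p k * (1 - (b ^ (k + 1)) ^ n) := by
    calc _ = ∑' k, ∑' n, p k * ((b * x) ^ n / c n * (1 - (b ^ (k + 1)) ^ n)) := by
          refine tsum_congr fun k => ?_
          rw [← (hs _).tsum_sub (hs _), ← tsum_mul_left]
          refine tsum_congr fun n => ?_
          rw [mul_pow (b ^ (k + 1))]
          ring
      _ = ∑' n, ∑' k, p k * ((b * x) ^ n / c n * (1 - (b ^ (k + 1)) ^ n)) :=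
          (Summable.tsum_comm (f := fun k n => p k * ((b * x) ^ n / c n * (1 - (b ^ (k + 1)) ^ n)))
            hF).symm
      _ = _ := by
          refine tsum_congr fun n => ?_
          rw [← tsum_mul_left]
          exact tsum_congr fun k => by ring
  have hs3 : Summable fun n => (b * x) ^ n / c n * ∑' k, p k * (1 - (b ^ (k + 1)) ^ n) := by
    have := hF.prod_symm.prod
    refine this.congr fun n => ?_
    rw [← tsum_mul_left]
    exact tsum_congr fun k => by simp only [Prod.fst_swap, Prod.snd_swap]; ring
  have hs1 : Summable fun n => w * (x ^ n / c n - (b * x) ^ n / c n) :=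
    ((hs x).sub (hs (b * x))).mul_left w
  rw [h3, ← (hs _).tsum_sub (hs _), ← tsum_mul_left, ← sub_eq_iff_eq_add, ← hs1.tsum_sub hs3,
    (hs1.sub hs3).tsum_eq_zero_add]
  simp only [pow_zero, sub_self, mul_zero, tsum_zero, zero_add]
  rw [← tsum_mul_left]
  refine tsum_congr fun n => ?_
  have h1 := hc n
  have h2 := hc (n + 1)
  have hb' : (b ^ (n + 1)) ≠ 0 := by positivity
  have key : w * (1 - b ^ (n + 1)) - b ^ (n + 1) * ∑' k, p k * (1 - (b ^ (k + 1)) ^ (n + 1)) =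
      b ^ (n + 1) * (c (n + 1) / c n) := by
    rw [hrec n]
    field_simp
  calc _ = x ^ (n + 1) / c (n + 1) * (w * (1 - b ^ (n + 1)) -
        b ^ (n + 1) * ∑' k, p k * (1 - (b ^ (k + 1)) ^ (n + 1))) := by
        rw [mul_pow b]; ring
    _ = _ := by
        rw [key, mul_pow b]
        field_simp
        ring

/-- Ratios `J (b x) / J x` of the eigenfunction `J` of an upward skip-free chain on the grid
`b ^ ℤ` are approximated by Laplace transforms of probability measures. -/
theorem exists_isLaplaceTransform_approx (hw : 0 < w) (hb : 0 < b) (hb1 : b < 1)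
    (hp : ∀ k, 0 ≤ p k) (hps : Summable p) (hc : ∀ n, 0 < c n) (hc0 : c 0 = 1)
    (hs : ∀ x : ℝ, Summable fun n => x ^ n / c n)
    (hrec : ∀ n, c (n + 1) =
      (w * ((b ^ (n + 1))⁻¹ - 1) - ∑' k, p k * (1 - (b ^ (k + 1)) ^ (n + 1))) * c n)
    {M ε : ℝ} (hM : 0 ≤ M) (hε : 0 < ε) :
    ∃ G : ℝ → ℝ, IsLaplaceTransform G ∧ G 0 = 1 ∧
      ∀ x ∈ Icc 0 M, |G x - (∑' n, (b * x) ^ n / c n) / ∑' n, x ^ n / c n| ≤ ε * x := by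
  set J : ℝ → ℝ := fun x => ∑' n, x ^ n / c n with hJ
  have hJ1 : ∀ x, 0 ≤ x → 1 ≤ J x := fun x hx => by
    have := (hs x).le_tsum 0 fun n _ => by have := hc n; positivity
    simpa [hc0] using this
  have hJmono : ∀ x y, 0 ≤ x → x ≤ y → J x ≤ J y := fun x y hx hxy =>
    (hs x).tsum_le_tsum (fun n => div_le_div_of_nonneg_right (pow_le_pow_left₀ hx hxy n)
      (hc n).le) (hs y)
  have hbx : ∀ x, 0 ≤ x → b * x ≤ x := fun x hx => mul_le_of_le_one_left hx hb1.le
  set g : ℝ → ℝ := fun x => J (b * x) / J x with hg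
  have hgI : ∀ x, 0 ≤ x → g x ∈ Icc (0 : ℝ) 1 := fun x hx => by
    have h1 := hJ1 x hx
    have h2 := hJ1 (b * x) (by positivity)
    exact ⟨by positivity, div_le_one_of_le₀ (hJmono _ _ (by positivity) (hbx x hx)) (by linarith)⟩
  have hprod : ∀ x, 0 ≤ x → ∀ k, ∏ i ∈ Finset.range k, g (b ^ (i + 1) * x) =
      J (b ^ k * (b * x)) / J (b * x) := fun x hx k => by
    induction k with
    | zero =>
      have := hJ1 (b * x) (by positivity)
      simp only [Finset.range_zero, Finset.prod_empty, pow_zero, one_mul]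
      rw [div_self (by linarith)]
    | succ k ih =>
      have h1 := hJ1 (b ^ k * (b * x)) (by positivity)
      have e1 : b ^ (k + 1) * x = b ^ k * (b * x) := by ring
      have e2 : b * (b ^ k * (b * x)) = b ^ (k + 1) * (b * x) := by ring
      rw [Finset.prod_range_succ, ih, hg]
      simp only
      rw [e1, e2, div_mul_div_comm, mul_comm, mul_div_mul_right _ _ (by linarith)]
  have hfix : ∀ x, 0 ≤ x → firstPassageStep w b p g x = g x := fun x hx => by
    have h1 := hJ1 x hx
    have h2 := hJ1 (b * x) (by positivity)
    have heig := tsum_pow_div_eigen hb hb1 hp hps hc hs hrec hx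
    have hden : w + (b * x + ∑' k, p k * (1 - ∏ i ∈ Finset.range (k + 1), g (b ^ (i + 1) * x))) =
        w * J x / J (b * x) := by
      have : ∑' k, p k * (1 - ∏ i ∈ Finset.range (k + 1), g (b ^ (i + 1) * x)) =
          (∑' k, p k * (J (b * x) - J (b ^ (k + 1) * (b * x)))) / J (b * x) := by
        rw [← tsum_div_const]
        refine tsum_congr fun k => ?_
        rw [hprod x hx]
        field_simp
      rw [this, eq_div_iff (by positivity), add_mul, add_mul, div_mul_cancel₀ _ (by positivity)]
      simp only [hJ] at heig ⊢
      linarith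
    rw [firstPassageStep, hden, hg]
    field_simp
  have hφ1 : ∑' k, p k * (1 - b ^ (k + 1)) < w * (b⁻¹ - 1) := by
    have := hrec 0
    simp only [zero_add, hc0, pow_one, mul_one] at this
    linarith [hc 1]
  set κ := (∑' k, p k * (1 - b ^ (k + 1))) * (b / (1 - b)) / w with hκ
  have hb1' : 0 < 1 - b := by linarith
  have hκ0 : 0 ≤ κ := by
    have : 0 ≤ ∑' k, p k * (1 - b ^ (k + 1)) := tsum_nonneg fun k => mul_nonneg (hp k)
      (by linarith [pow_le_one₀ (n := k + 1) hb.le hb1.le])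
    positivity
  have hκ1 : κ < 1 := by
    rw [hκ, div_lt_one hw]
    calc _ < w * (b⁻¹ - 1) * (b / (1 - b)) := mul_lt_mul_of_pos_right hφ1 (by positivity)
      _ = w := by field_simp
  set C : ℝ := ∑' n, M ^ n / c (n + 1) with hC
  have hsC : Summable fun n => M ^ n / c (n + 1) := by
    rcases hM.eq_or_lt with rfl | hM
    · refine summable_of_ne_finset_zero (s := {0}) fun n hn => ?_
      simp at hn
      simp [hn]
    · refine (((summable_nat_add_iff 1).2 (hs M)).mul_left M⁻¹).congr fun n => ?_
      rw [pow_succ]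
      field_simp
  set T : ℕ → ℝ → ℝ := fun n => (firstPassageStep w b p)^[n] fun _ => 1 with hT
  have hTs : ∀ n, T (n + 1) = firstPassageStep w b p (T n) := fun n =>
    Function.iterate_succ_apply' _ _ _
  have hTI : ∀ n x, 0 ≤ x → T n x ∈ Icc (0 : ℝ) 1 := fun n => by
    induction n with
    | zero => intro x _; simp [hT]
    | succ n ih => intro x hx; rw [hTs]; exact firstPassageStep_mem_Icc hw hb.le hp ih hx
  have hTL : ∀ n, IsLaplaceTransform (T n) := fun n => by
    induction n with
    | zero => exact IsLaplaceTransform.one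
    | succ n ih =>
      rw [hTs]; exact ih.firstPassage (fun x hx => (hTI n x hx).2) hp hps hw hb.le
  have hT0 : ∀ n, T n 0 = 1 := fun n => by
    induction n with
    | zero => rfl
    | succ n ih => rw [hTs]; exact firstPassageStep_zero hw ih
  have hTg : ∀ n, ∀ x ∈ Icc 0 M, |T n x - g x| ≤ C * κ ^ n * x := fun n => by
    induction n with
    | zero =>
      intro x hx
      have h1 := hJ1 x hx.1
      have hT00 : T 0 x = 1 := rfl
      rw [hT00, abs_of_nonneg (by linarith [(hgI x hx.1).2]), pow_zero, mul_one]
      have h2 : J x - J (b * x) ≤ C * x := by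
        simp only [hJ]
        rw [← (hs _).tsum_sub (hs _), ((hs _).sub (hs _)).tsum_eq_zero_add]
        simp only [pow_zero, sub_self, zero_add]
        rw [hC, ← tsum_mul_right]
        refine Summable.tsum_le_tsum (fun n => ?_)
          ((summable_nat_add_iff 1).2 ((hs x).sub (hs (b * x)))) (hsC.mul_right x)
        have := hc (n + 1)
        have hx0 := hx.1
        rw [← sub_div, div_mul_eq_mul_div]
        refine div_le_div_of_nonneg_right ?_ this.le
        have : 0 ≤ (b * x) ^ (n + 1) := by positivity
        calc x ^ (n + 1) - (b * x) ^ (n + 1) ≤ x ^ n * x := by rw [← pow_succ]; linarith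
          _ ≤ _ := mul_le_mul_of_nonneg_right (pow_le_pow_left₀ hx.1 hx.2 n) hx.1
      have h3 : 0 ≤ C * x :=
        mul_nonneg (tsum_nonneg fun n => by have := hc (n + 1); positivity) hx.1
      have : 1 - g x = (J x - J (b * x)) / J x := by rw [hg]; field_simp
      rw [this]
      exact (div_le_div_of_nonneg_right h2 (by linarith)).trans (div_le_self h3 h1)
    | succ n ih =>
      intro x hx
      rw [hTs, ← hfix x hx.1, pow_succ, ← mul_assoc]
      exact abs_firstPassageStep_sub_le hw hb hb1 hp hps (hTI n) hgI ih hx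
  have htend : Tendsto (fun n => C * κ ^ n) atTop (𝓝 0) := by
    simpa using (tendsto_pow_atTop_nhds_zero_of_lt_one hκ0 hκ1).const_mul C
  obtain ⟨n, hn⟩ := (htend.eventually (gt_mem_nhds hε)).exists
  exact ⟨T n, hTL n, hT0 n, fun x hx =>
    (hTg n x hx).trans (mul_le_mul_of_nonneg_right hn.le hx.1)⟩

end SkipFree

theorem IsLaplaceTransform.exists_antitone_tail {G : ℝ → ℝ} (hG : IsLaplaceTransform G)
    (hG0 : G 0 = 1) {δ : ℝ} (hδ : 0 < δ) :
    ∃ k : ℝ → ℝ, Antitone k ∧ (∀ r, 0 ≤ k r) ∧ ∀ q, 0 < q →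
      IntegrableOn (fun r => exp (-(q * r)) * k r) (Ioi 0) ∧
        ∫ r in Ioi 0, exp (-(q * r)) * k r = (1 - G q) / (δ * q) := by
  obtain ⟨μ, hμ⟩ := hG
  have hfin := isFiniteMeasure hμ
  have huniv : μ univ = 1 := by rw [measure_univ_eq hμ, hG0, ENNReal.ofReal_one]
  have hanti : Antitone fun r : ℝ => μ.real {a : ℝ≥0 | r < a} := fun r s hrs =>
    measureReal_mono fun a (ha : s < a) => hrs.trans_lt ha
  have hanti' : Antitone fun r : ℝ => μ.real {a : ℝ≥0 | r < a} / δ := fun r s hrs =>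
    div_le_div_of_nonneg_right (hanti hrs) hδ.le
  refine ⟨_, hanti', fun r => by positivity, fun q hq => ?_⟩
  have hcompl : ∫⁻ r : ℝ≥0, ENNReal.ofReal (1 - exp (-(q * r))) ∂μ = ENNReal.ofReal (1 - G q) := by
    have hadd : ∫⁻ r : ℝ≥0, ENNReal.ofReal (1 - exp (-(q * r))) ∂μ + ENNReal.ofReal (G q) = 1 := by
      rw [← (hμ q hq.le).2, ← lintegral_add_right _ (by fun_prop), ← huniv, ← lintegral_one]
      refine lintegral_congr fun r => ?_
      rw [← ENNReal.ofReal_add _ (exp_nonneg _), sub_add_cancel, ENNReal.ofReal_one]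
      rw [sub_nonneg, Real.exp_le_one_iff]
      have : 0 ≤ q * r := by positivity
      linarith
    rw [ENNReal.ofReal_sub _ (hμ q hq.le).1, ENNReal.ofReal_one, ← hadd,
      ENNReal.add_sub_cancel_right ENNReal.ofReal_ne_top]
  have hlayer := lintegral_comp_eq_lintegral_meas_lt_mul μ (f := fun r : ℝ≥0 => (r : ℝ))
    (g := fun t => q * exp (-(q * t))) (ae_of_all _ fun r => r.2) (by fun_prop)
    (fun t _ => Continuous.intervalIntegrable (by fun_prop) _ _)
    (ae_of_all _ fun t => by positivity)
  have hint : ∀ r : ℝ, ∫ t in (0 : ℝ)..r, q * exp (-(q * t)) = 1 - exp (-(q * r)) := fun r => by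
    have hd : ∀ t ∈ uIcc 0 r, HasDerivAt (fun t => -exp (-(q * t))) (q * exp (-(q * t))) t :=
      fun t _ => by
        refine (((hasDerivAt_id t).const_mul q).neg.exp).neg.congr_deriv ?_
        simp
        ring
    rw [intervalIntegral.integral_eq_sub_of_hasDerivAt hd
      (Continuous.intervalIntegrable (by fun_prop) _ _)]
    simp
    ring
  simp only [hint, hcompl] at hlayer
  have hlin : ∫⁻ r in Ioi 0, ENNReal.ofReal (exp (-(q * r)) * (μ.real {a : ℝ≥0 | r < a} / δ)) =
      ENNReal.ofReal ((1 - G q) / (δ * q)) := by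
    rw [div_eq_mul_inv, mul_comm, ENNReal.ofReal_mul (by positivity), hlayer,
      ← lintegral_const_mul']
    · refine lintegral_congr fun r => ?_
      rw [← ofReal_measureReal, ← ENNReal.ofReal_mul (by positivity),
        ← ENNReal.ofReal_mul (by positivity)]
      congr 1
      field_simp
    · exact ENNReal.ofReal_ne_top
  have hmeas : Measurable fun r : ℝ => exp (-(q * r)) * (μ.real {a : ℝ≥0 | r < a} / δ) :=
    (by fun_prop : Measurable fun r : ℝ => exp (-(q * r))).mul hanti'.measurable
  have hnn : 0 ≤ᵐ[volume.restrict (Ioi 0)]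
      fun r : ℝ => exp (-(q * r)) * (μ.real {a : ℝ≥0 | r < a} / δ) :=
    ae_of_all _ fun r => by positivity
  refine ⟨⟨hmeas.aestronglyMeasurable, ?_⟩, ?_⟩
  · rw [hasFiniteIntegral_iff_ofReal hnn, hlin]
    exact ENNReal.ofReal_lt_top
  · rw [integral_eq_lintegral_of_nonneg_ae hnn hmeas.aestronglyMeasurable, hlin,
      ENNReal.toReal_ofReal]
    have hle : G q ≤ 1 := by
      have h := (hμ q hq.le).2
      have h' : ∫⁻ r : ℝ≥0, ENNReal.ofReal (exp (-(q * r))) ∂μ ≤ 1 := by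
        rw [← huniv, ← lintegral_one]
        refine lintegral_mono fun r => ENNReal.ofReal_le_one.2 (Real.exp_le_one_iff.2 ?_)
        have : 0 ≤ q * r := by positivity
        linarith
      rw [h] at h'
      exact ENNReal.ofReal_le_one.1 h'
    have : 0 ≤ 1 - G q := by linarith
    positivity

theorem Antitone.mul_exp_mul_le_integral {k : ℝ → ℝ} (hk : Antitone k) (hk0 : ∀ r, 0 ≤ k r)
    {q : ℝ} (hq : 0 < q) (hint : IntegrableOn (fun r => exp (-(q * r)) * k r) (Ioi 0))
    {r : ℝ} (hr : 0 < r) :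
    r * (exp (-(q * r)) * k r) ≤ ∫ s in Ioi 0, exp (-(q * s)) * k s := by
  have h1 : ∫ _ in Ioc 0 r, exp (-(q * r)) * k r = r * (exp (-(q * r)) * k r) := by
    simp [hr.le]
  rw [← h1]
  refine (setIntegral_mono_on (integrableOn_const (by simp)) (hint.mono_set Ioc_subset_Ioi_self)
    measurableSet_Ioc fun s hs => ?_).trans (setIntegral_mono_set hint
      (ae_of_all _ fun s => by have := hk0 s; positivity) Ioc_subset_Ioi_self.eventuallyLE)
  refine mul_le_mul (Real.exp_le_exp.2 ?_) (hk hs.2) (hk0 r) (exp_nonneg _)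
  have := mul_le_mul_of_nonneg_left hs.2 hq.le
  linarith

/-- Helly's selection theorem for nonnegative antitone functions on `(0,∞)`. -/
theorem exists_subseq_tendsto_ae_of_antitone {k : ℕ → ℝ → ℝ} (hk : ∀ n, Antitone (k n))
    (hk0 : ∀ n r, 0 ≤ k n r) {B : ℝ → ℝ} (hB : ∀ n r, 0 < r → k n r ≤ B r) :
    ∃ (φ : ℕ → ℕ) (κ : ℝ → ℝ), StrictMono φ ∧ AntitoneOn κ (Ioi 0) ∧ (∀ r, 0 < r → 0 ≤ κ r) ∧
      ∀ᵐ r ∂volume.restrict (Ioi 0), Tendsto (fun n => k (φ n) r) atTop (𝓝 (κ r)) := by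
  have hcomp : IsCompact (Set.univ.pi fun s : {s : ℚ // 0 < s} =>
      Icc (0 : ℝ) (B ((s : ℚ) : ℝ))) :=
    isCompact_univ_pi fun _ => isCompact_Icc
  obtain ⟨K, hK, φ, hφ, hlim⟩ := hcomp.tendsto_subseq
    (x := fun n (s : {s : ℚ // 0 < s}) => k n ((s : ℚ) : ℝ))
    fun n s _ => ⟨hk0 n _, hB n _ (by exact_mod_cast s.2)⟩
  rw [tendsto_pi_nhds] at hlim
  simp only [Function.comp_def] at hlim
  set A : ℝ → Set ℝ := fun r => K '' {s | ((s : ℚ) : ℝ) < r} with hA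
  have hbdd : ∀ r, BddBelow (A r) := fun r => ⟨0, by
    rintro _ ⟨s, -, rfl⟩
    exact (hK s (mem_univ s)).1⟩
  have hne : ∀ r, 0 < r → (A r).Nonempty := fun r hr => by
    obtain ⟨s, hs0, hsr⟩ := exists_rat_btwn hr
    exact ⟨_, ⟨s, by exact_mod_cast hs0⟩, hsr, rfl⟩
  have hanti : AntitoneOn (fun r => sInf (A r)) (Ioi 0) := fun r hr r' _ hrr' =>
    csInf_le_csInf (hbdd r') (hne r hr) (image_mono fun s (hs : _ < r) => hs.trans_le hrr')
  refine ⟨φ, fun r => sInf (A r), hφ, hanti, fun r hr => le_csInf (hne r hr) ?_, ?_⟩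
  · rintro _ ⟨s, -, rfl⟩
    exact (hK s (mem_univ s)).1
  · rw [ae_restrict_iff' measurableSet_Ioi]
    have hc := hanti.countable_not_continuousWithinAt.ae_notMem volume
    filter_upwards [hc] with r hr hr0
    have hcont : ContinuousWithinAt (fun r => sInf (A r)) (Ioi 0) r := by
      by_contra h
      exact hr ⟨hr0, h⟩
    have hcont' := hcont.continuousAt (Ioi_mem_nhds hr0)
    refine tendsto_order.2 ⟨fun u hu => ?_, fun u hu => ?_⟩
    · have hev : ∀ᶠ t in 𝓝[>] r, u < sInf (A t) :=
        (hcont'.eventually (lt_mem_nhds hu)).filter_mono nhdsWithin_le_nhds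
      obtain ⟨t, ht, hrt⟩ := (hev.and self_mem_nhdsWithin).exists
      obtain ⟨s, hrs, hst⟩ := exists_rat_btwn (show r < t from hrt)
      have hs0 : 0 < s := by exact_mod_cast (show (0 : ℝ) < r from hr0).trans hrs
      have : u < K ⟨s, hs0⟩ := ht.trans_le (csInf_le (hbdd t) ⟨⟨s, hs0⟩, hst, rfl⟩)
      filter_upwards [(hlim ⟨s, hs0⟩).eventually (lt_mem_nhds this)] with n hn
      exact hn.trans_le (hk _ hrs.le)
    · obtain ⟨_, ⟨s, hsr, rfl⟩, hs⟩ := exists_lt_of_csInf_lt (hne r hr0) hu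
      filter_upwards [(hlim s).eventually (gt_mem_nhds hs)] with n hn
      exact (hk _ (le_of_lt hsr)).trans_lt hn

theorem exists_laplace_representation_of_tendsto {G : ℕ → ℝ → ℝ}
    (hG : ∀ n, IsLaplaceTransform (G n)) (hG0 : ∀ n, G n 0 = 1) {δ : ℕ → ℝ} (hδ : ∀ n, 0 < δ n)
    {D : ℝ → ℝ} (hD : ∀ q, 0 < q → Tendsto (fun n => (1 - G n q) / (δ n * q)) atTop (𝓝 (D q))) :
    ∃ a : ℝ, 0 ≤ a ∧ ∃ k : ℝ → ℝ, (∀ r, 0 < r → 0 ≤ k r) ∧ AntitoneOn k (Ioi 0) ∧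
      ∀ q, 0 < q → IntegrableOn (fun r => exp (-(q * r)) * k r) (Ioi 0) ∧
        D q = a + ∫ r in Ioi 0, exp (-(q * r)) * k r := by
  choose k hanti hk0 hkint using fun n => (hG n).exists_antitone_tail (hG0 n) (hδ n)
  have hlim : ∀ q, 0 < q →
      Tendsto (fun n => ∫ r in Ioi 0, exp (-(q * r)) * k n r) atTop (𝓝 (D q)) := fun q hq => by
    simpa only [(hkint _ q hq).2] using hD q hq
  have hbd : ∀ q, 0 < q → ∃ B, ∀ n r, 0 < r → r * (exp (-(q * r)) * k n r) ≤ B := fun q hq => by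
    obtain ⟨B, hB⟩ := (hlim q hq).bddAbove_range
    exact ⟨B, fun n r hr => ((hanti n).mul_exp_mul_le_integral (hk0 n) hq (hkint n q hq).1 hr).trans
      (hB ⟨n, rfl⟩)⟩
  obtain ⟨B₁, hB₁⟩ := hbd 1 one_pos
  obtain ⟨φ, κ, hφ, hκanti, hκ0, hκlim⟩ := exists_subseq_tendsto_ae_of_antitone hanti hk0
    (B := fun r => B₁ / (r * exp (-(1 * r)))) fun n r hr => by
      rw [le_div_iff₀ (by positivity)]
      linarith [hB₁ n r hr]
  have hκmeas : AEStronglyMeasurable κ (volume.restrict (Ioi 0)) :=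
    (aemeasurable_restrict_of_antitoneOn measurableSet_Ioi hκanti).aestronglyMeasurable
  have hmeas : ∀ q, AEStronglyMeasurable (fun r => exp (-(q * r)) * κ r)
      (volume.restrict (Ioi 0)) := fun q =>
    (by fun_prop : Continuous fun r : ℝ => exp (-(q * r))).aestronglyMeasurable.mul hκmeas
  have hlim' : ∀ q, 0 < q →
      Tendsto (fun n => ∫ r in Ioi 0, exp (-(q * r)) * k (φ n) r) atTop (𝓝 (D q)) := fun q hq =>
    (hlim q hq).comp hφ.tendsto_atTop
  have hD0 : ∀ q, 0 < q → 0 ≤ D q := fun q hq => ge_of_tendsto' (hlim q hq) fun n =>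
    integral_nonneg fun r => by have := hk0 n r; positivity
  have hnnκ : ∀ q, 0 ≤ᵐ[volume.restrict (Ioi 0)] fun r => exp (-(q * r)) * κ r := fun q => by
    filter_upwards [ae_restrict_mem measurableSet_Ioi] with r hr
    have := hκ0 r hr
    simp only [Pi.zero_apply]
    positivity
  have hfatou : ∀ q, 0 < q →
      ∫⁻ r in Ioi 0, ENNReal.ofReal (exp (-(q * r)) * κ r) ≤ ENNReal.ofReal (D q) := fun q hq => by
    have hl : Tendsto (fun n => ∫⁻ r in Ioi 0, ENNReal.ofReal (exp (-(q * r)) * k (φ n) r)) atTop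
        (𝓝 (ENNReal.ofReal (D q))) := by
      refine (ENNReal.tendsto_ofReal (hlim' q hq)).congr fun n => ?_
      exact ofReal_integral_eq_lintegral_ofReal (hkint _ q hq).1
        (ae_of_all _ fun r => by have := hk0 (φ n) r; simp only [Pi.zero_apply]; positivity)
    rw [← hl.liminf_eq]
    refine le_trans (lintegral_mono_ae ?_) (lintegral_liminf_le fun n => ?_)
    · filter_upwards [hκlim] with r hr
      rw [(ENNReal.tendsto_ofReal (hr.const_mul (exp (-(q * r))))).liminf_eq]
    · exact ((by fun_prop : Measurable fun r : ℝ => exp (-(q * r))).mul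
        (hanti _).measurable).ennreal_ofReal
  have hint : ∀ q, 0 < q → IntegrableOn (fun r => exp (-(q * r)) * κ r) (Ioi 0) := fun q hq =>
    ⟨hmeas q, by
      rw [hasFiniteIntegral_iff_ofReal (hnnκ q)]
      exact (hfatou q hq).trans_lt ENNReal.ofReal_lt_top⟩
  have hle : ∀ q, 0 < q → ∫ r in Ioi 0, exp (-(q * r)) * κ r ≤ D q := fun q hq => by
    rw [integral_eq_lintegral_of_nonneg_ae (hnnκ q) (hmeas q)]
    exact ENNReal.toReal_le_of_le_ofReal (hD0 q hq) (hfatou q hq)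
  have hdiff : ∀ q q', 0 < q → q < q' → D q - D q' =
      ∫ r in Ioi 0, exp (-(q * r)) * κ r - exp (-(q' * r)) * κ r := fun q q' hq hqq' => by
    obtain ⟨B, hB⟩ := hbd (q / 2) (by positivity)
    refine tendsto_nhds_unique ((hlim' q hq).sub (hlim' q' (hq.trans hqq'))) ?_
    simp only [← integral_sub (hkint _ q hq).1 (hkint _ q' (hq.trans hqq')).1]
    refine tendsto_integral_of_dominated_convergence
      (fun r => (q' - q) * B * exp (-(q / 2) * r)) (fun n => ?_)
      ((integrableOn_exp_mul_Ioi (by linarith) 0).const_mul _) (fun n => ?_) ?_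
    · exact ((hkint _ q hq).1.sub (hkint _ q' (hq.trans hqq')).1).aestronglyMeasurable
    · filter_upwards [ae_restrict_mem measurableSet_Ioi] with r hr
      have hr' : 0 < r := hr
      have e1 : exp (-(q * r)) = exp (-(q / 2) * r) * exp (-(q / 2 * r)) := by
        rw [← Real.exp_add]; congr 1; ring
      have e2 : exp (-(q' * r)) = exp (-(q * r)) * exp (-((q' - q) * r)) := by
        rw [← Real.exp_add]; congr 1; ring
      have h1 : 1 - exp (-((q' - q) * r)) ≤ (q' - q) * r := by
        linarith [Real.add_one_le_exp (-((q' - q) * r))]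
      have h2 : 0 ≤ 1 - exp (-((q' - q) * r)) := by
        have : 0 ≤ (q' - q) * r := mul_nonneg (by linarith) hr'.le
        rw [sub_nonneg, Real.exp_le_one_iff]
        linarith
      have hkn := hk0 (φ n) r
      have e3 : exp (-(q * r)) * k (φ n) r - exp (-(q' * r)) * k (φ n) r =
          (1 - exp (-((q' - q) * r))) *
            (exp (-(q / 2) * r) * (exp (-(q / 2 * r)) * k (φ n) r)) := by
        rw [e2, e1]; ring
      rw [e3, Real.norm_of_nonneg (by positivity)]
      calc _ ≤ (q' - q) * r * (exp (-(q / 2) * r) * (exp (-(q / 2 * r)) * k (φ n) r)) :=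
            mul_le_mul_of_nonneg_right h1 (by positivity)
        _ = (q' - q) * exp (-(q / 2) * r) * (r * (exp (-(q / 2 * r)) * k (φ n) r)) := by ring
        _ ≤ (q' - q) * exp (-(q / 2) * r) * B :=
            mul_le_mul_of_nonneg_left (hB _ r hr') (mul_nonneg (by linarith) (exp_nonneg _))
        _ = _ := by ring
    · filter_upwards [hκlim] with r hr
      exact (hr.const_mul _).sub (hr.const_mul _)
  have hconst : ∀ q q', 0 < q → q < q' → D q - ∫ r in Ioi 0, exp (-(q * r)) * κ r =
      D q' - ∫ r in Ioi 0, exp (-(q' * r)) * κ r := fun q q' hq hqq' => by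
    have := hdiff q q' hq hqq'
    rw [integral_sub (hint q hq) (hint q' (hq.trans hqq'))] at this
    linarith
  refine ⟨D 1 - ∫ r in Ioi 0, exp (-(1 * r)) * κ r, by linarith [hle 1 one_pos], κ, hκ0, hκanti,
    fun q hq => ⟨hint q hq, ?_⟩⟩
  rcases lt_trichotomy q 1 with h | rfl | h
  · linarith [hconst q 1 hq h]
  · ring
  · linarith [hconst 1 q one_pos h]

theorem min_one_le_two_mul_one_sub_exp_neg {r : ℝ} (hr : 0 < r) :
    min 1 r ≤ 2 * (1 - exp (-r)) := by
  have h1 : exp (-r) ≤ 1 / (1 + r) := by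
    rw [Real.exp_neg, ← one_div]
    exact one_div_le_one_div_of_le (by positivity) (by linarith [Real.add_one_le_exp r])
  have h2 : min 1 r ≤ 2 * (1 - 1 / (1 + r)) := by
    have : 2 * (1 - 1 / (1 + r)) = 2 * r / (1 + r) := by field_simp; ring
    rw [this, le_div_iff₀ (by positivity)]
    rcases le_total r 1 with h | h
    · rw [min_eq_right h]; nlinarith
    · rw [min_eq_left h]; linarith
  linarith

theorem integral_laplace_representation {J J' k : ℝ → ℝ} {a : ℝ} (ha : 0 ≤ a)
    (hJ0 : J 0 = 1) (hJpos : ∀ x, 0 ≤ x → 0 < J x) (hJd : ∀ x, 0 ≤ x → HasDerivAt J (J' x) x)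
    (hk0 : ∀ r, 0 < r → 0 ≤ k r) (hk : AntitoneOn k (Ioi 0))
    (hrep : ∀ q, 0 < q → IntegrableOn (fun r => exp (-(q * r)) * k r) (Ioi 0) ∧
      J' q / J q = a + ∫ r in Ioi 0, exp (-(q * r)) * k r) {q : ℝ} (hq : 0 < q) :
    IntegrableOn (fun r => (1 - exp (-q * r)) * (k r / r)) (Ioi 0) ∧
      log (J q) = a * q + ∫ r in Ioi 0, (1 - exp (-q * r)) * (k r / r) := by
  have hkmeas : AEMeasurable k (volume.restrict (Ioi 0)) :=
    aemeasurable_restrict_of_antitoneOn measurableSet_Ioi hk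
  have hkint0 : ∀ s, 0 ≤ᵐ[volume.restrict (Ioi 0)] fun r => exp (-(s * r)) * k r := fun s => by
    filter_upwards [ae_restrict_mem measurableSet_Ioi] with r hr
    have := hk0 r hr
    simp only [Pi.zero_apply]
    positivity
  have hrep0 : ∀ s, 0 < s → 0 ≤ J' s / J s := fun s hs => by
    rw [(hrep s hs).2]
    exact add_nonneg ha (integral_nonneg_of_ae (hkint0 s))
  have hlogd : ∀ x, 0 ≤ x → HasDerivAt (fun x => log (J x)) (J' x / J x) x := fun x hx =>
    (hJd x hx).log (hJpos x hx).ne'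
  have hcont : ContinuousOn (fun x => log (J x)) (uIcc 0 q) := fun x hx => by
    rw [uIcc_of_le hq.le] at hx
    exact (hlogd x hx.1).continuousAt.continuousWithinAt
  have hii : IntervalIntegrable (fun x => J' x / J x) volume 0 q := by
    refine intervalIntegral.intervalIntegrable_deriv_of_nonneg hcont (fun x hx => ?_) fun x hx => ?_
    · rw [min_eq_left hq.le] at hx
      exact hlogd x hx.1.le
    · rw [min_eq_left hq.le] at hx
      exact hrep0 x hx.1
  have hftc : ∫ s in (0 : ℝ)..q, J' s / J s = log (J q) := by
    rw [intervalIntegral.integral_eq_sub_of_hasDerivAt (fun x hx => by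
      rw [uIcc_of_le hq.le] at hx
      exact hlogd x hx.1) hii, hJ0, Real.log_one, sub_zero]
  have hlin : ENNReal.ofReal (log (J q)) = ENNReal.ofReal (a * q) +
      ∫⁻ r in Ioi 0, ENNReal.ofReal ((1 - exp (-q * r)) * (k r / r)) := by
    rw [← hftc, intervalIntegral.integral_of_le hq.le, ofReal_integral_eq_lintegral_ofReal
      ((intervalIntegrable_iff_integrableOn_Ioc_of_le hq.le).1 hii)
      ((ae_restrict_mem measurableSet_Ioc).mono fun s hs => hrep0 s hs.1)]
    have hinner : ∀ s ∈ Ioc 0 q, ENNReal.ofReal (J' s / J s) = ENNReal.ofReal a +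
        ∫⁻ r in Ioi 0, ENNReal.ofReal (exp (-(s * r)) * k r) := fun s hs => by
      rw [(hrep s hs.1).2, ENNReal.ofReal_add ha (integral_nonneg_of_ae (hkint0 s)),
        ofReal_integral_eq_lintegral_ofReal (hrep s hs.1).1 (hkint0 s)]
    rw [setLIntegral_congr_fun measurableSet_Ioc hinner, lintegral_add_left measurable_const,
      setLIntegral_const, Real.volume_Ioc, sub_zero, ← ENNReal.ofReal_mul ha,
      lintegral_lintegral_swap]
    · congr 1
      refine setLIntegral_congr_fun measurableSet_Ioi fun r (hr : 0 < r) => ?_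
      have hkr := hk0 r hr
      have hint : IntervalIntegrable (fun s => exp (-(s * r)) * k r) volume 0 q :=
        Continuous.intervalIntegrable (by fun_prop) _ _
      rw [← ofReal_integral_eq_lintegral_ofReal
        ((intervalIntegrable_iff_integrableOn_Ioc_of_le hq.le).1 hint)
        (ae_of_all _ fun s => by simp only [Pi.zero_apply]; positivity),
        ← intervalIntegral.integral_of_le hq.le]
      have hd : ∀ s ∈ uIcc 0 q, HasDerivAt (fun s => -exp (-(s * r)) * (k r / r))
          (exp (-(s * r)) * k r) s := fun s _ => by
        refine ((((hasDerivAt_id s).mul_const r).neg.exp).neg.mul_const (k r / r)).congr_deriv ?_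
        simp
        field_simp
      rw [intervalIntegral.integral_eq_sub_of_hasDerivAt hd hint]
      congr 1
      simp
      ring
    · refine AEMeasurable.ennreal_ofReal (AEMeasurable.mul ?_ hkmeas.comp_snd)
      exact (by fun_prop : Measurable fun z : ℝ × ℝ => exp (-(z.1 * z.2))).aemeasurable
  have hnn : 0 ≤ᵐ[volume.restrict (Ioi 0)] fun r => (1 - exp (-q * r)) * (k r / r) := by
    filter_upwards [ae_restrict_mem measurableSet_Ioi] with r hr
    have hr' : 0 < r := hr
    have := hk0 r hr
    have : 0 ≤ 1 - exp (-q * r) := by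
      rw [sub_nonneg, Real.exp_le_one_iff, neg_mul]
      have : 0 ≤ q * r := by positivity
      linarith
    simp only [Pi.zero_apply]
    positivity
  have hmeas : AEStronglyMeasurable (fun r => (1 - exp (-q * r)) * (k r / r))
      (volume.restrict (Ioi 0)) := by
    refine AEMeasurable.aestronglyMeasurable (AEMeasurable.mul ?_ (hkmeas.div aemeasurable_id))
    exact (by fun_prop : Measurable fun r : ℝ => 1 - exp (-q * r)).aemeasurable
  have hfin : ∫⁻ r in Ioi 0, ENNReal.ofReal ((1 - exp (-q * r)) * (k r / r)) ≠ ∞ := fun h => by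
    rw [h, add_top] at hlin
    exact ENNReal.ofReal_ne_top hlin
  have hint : IntegrableOn (fun r => (1 - exp (-q * r)) * (k r / r)) (Ioi 0) :=
    ⟨hmeas, by rw [hasFiniteIntegral_iff_ofReal hnn]; exact hfin.lt_top⟩
  refine ⟨hint, ?_⟩
  rw [← ofReal_integral_eq_lintegral_ofReal hint hnn, ← ENNReal.ofReal_add (by positivity)
    (integral_nonneg_of_ae hnn)] at hlin
  refine (ENNReal.ofReal_eq_ofReal_iff ?_ (add_nonneg (by positivity)
    (integral_nonneg_of_ae hnn))).1 hlin
  rw [← hftc]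
  rw [intervalIntegral.integral_of_le hq.le]
  exact setIntegral_nonneg measurableSet_Ioc fun s hs => hrep0 s hs.1

theorem integrableOn_min_one_mul {k : ℝ → ℝ} (hk0 : ∀ r, 0 < r → 0 ≤ k r)
    (hk : AntitoneOn k (Ioi 0))
    (h : IntegrableOn (fun r => (1 - exp (-1 * r)) * (k r / r)) (Ioi 0)) :
    IntegrableOn (fun r => min 1 r * (k r / r)) (Ioi 0) := by
  have hkmeas : AEMeasurable k (volume.restrict (Ioi 0)) :=
    aemeasurable_restrict_of_antitoneOn measurableSet_Ioi hk
  refine (h.const_mul 2).mono' ?_ ?_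
  · refine AEMeasurable.aestronglyMeasurable (AEMeasurable.mul ?_ (hkmeas.div aemeasurable_id))
    exact (by fun_prop : Measurable fun r : ℝ => min 1 r).aemeasurable
  · filter_upwards [ae_restrict_mem measurableSet_Ioi] with r hr
    have hr' : 0 < r := hr
    have := hk0 r hr
    rw [Real.norm_of_nonneg (by positivity), ← mul_assoc, neg_one_mul]
    exact mul_le_mul_of_nonneg_right (min_one_le_two_mul_one_sub_exp_neg hr') (by positivity)

theorem rpow_sub_rpow_le_exp_mul {ρ : ℝ} (h1 : 1 < ρ) (h2 : ρ < 2) {x y : ℝ} (hx : 0 ≤ x)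
    (hxy : x ≤ y) :
    y ^ ρ - x ^ ρ ≤ exp y * (1 - exp (-y)) ^ ρ - exp x * (1 - exp (-x)) ^ ρ := by
  have hmono : MonotoneOn (fun s : ℝ => exp s * (1 - exp (-s)) ^ ρ - s ^ ρ) (Ici 0) := by
    have hd : ∀ s : ℝ, HasDerivAt (fun s : ℝ => exp s * (1 - exp (-s)) ^ ρ - s ^ ρ)
        (exp s * (1 - exp (-s)) ^ ρ + exp s * (exp (-s) * ρ * (1 - exp (-s)) ^ (ρ - 1)) -
          ρ * s ^ (ρ - 1)) s := fun s => by
      have h3 : HasDerivAt (fun s : ℝ => 1 - exp (-s)) (exp (-s)) s := by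
        simpa using ((hasDerivAt_neg s).exp).const_sub 1
      exact ((Real.hasDerivAt_exp s).mul (h3.rpow_const (Or.inr h1.le))).sub
        (Real.hasDerivAt_rpow_const (Or.inr h1.le))
    refine monotoneOn_of_hasDerivWithinAt_nonneg (convex_Ici 0)
      (fun s _ => (hd s).continuousAt.continuousWithinAt) (fun s _ => (hd s).hasDerivWithinAt)
      fun s hs => ?_
    rw [interior_Ici] at hs
    have hs : 0 < s := hs
    set u := 1 - exp (-s) with hu
    have hu0 : 0 < u := by
      rw [hu, sub_pos, Real.exp_lt_one_iff]
      linarith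
    have hus : u ≤ s := by linarith [Real.add_one_le_exp (-s)]
    have hpow : u ^ ρ = u * u ^ (ρ - 1) := by
      rw [Real.rpow_sub_one hu0.ne']
      field_simp
    have hle : u / s ≤ u ^ (ρ - 1) / s ^ (ρ - 1) := by
      rw [← Real.div_rpow hu0.le hs.le]
      have := Real.rpow_le_rpow_of_exponent_ge (x := u / s) (by positivity)
        ((div_le_one hs).2 hus) (by linarith : ρ - 1 ≤ 1)
      rwa [Real.rpow_one] at this
    rw [div_le_div_iff₀ hs (by positivity)] at hle
    have hee : exp s * exp (-s) = 1 := by rw [← Real.exp_add]; simp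
    have hsinh : s ≤ (exp s - exp (-s)) / 2 := by
      rw [← Real.sinh_eq]
      exact Real.self_le_sinh_iff.2 hs.le
    have hkey : ρ * s ≤ u * (exp s - 1 + ρ) := by
      have h4 : 0 ≤ s - 1 + exp (-s) := by linarith [Real.add_one_le_exp (-s)]
      rw [hu]
      nlinarith
    have hP : 0 ≤ s ^ (ρ - 1) := by positivity
    have hA : exp s * u ^ ρ + exp s * (exp (-s) * ρ * u ^ (ρ - 1)) =
        u ^ (ρ - 1) * (exp s - 1 + ρ) := by
      rw [hpow]
      have : exp s * u = exp s - 1 := by rw [hu]; linarith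
      linear_combination u ^ (ρ - 1) * this + ρ * u ^ (ρ - 1) * hee
    rw [hA, sub_nonneg]
    have hB : 0 ≤ exp s - 1 + ρ := by linarith [Real.add_one_le_exp s]
    refine le_of_mul_le_mul_right ?_ hs
    calc ρ * s ^ (ρ - 1) * s = s ^ (ρ - 1) * (ρ * s) := by ring
      _ ≤ s ^ (ρ - 1) * (u * (exp s - 1 + ρ)) := by gcongr
      _ = u * s ^ (ρ - 1) * (exp s - 1 + ρ) := by ring
      _ ≤ u ^ (ρ - 1) * s * (exp s - 1 + ρ) := by gcongr
      _ = _ := by ring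
  have := hmono hx (hx.trans hxy : (0 : ℝ) ≤ y) hxy
  simp only at this
  linarith

theorem tendsto_one_sub_exp_neg_div (s : ℝ) :
    Tendsto (fun h : ℝ => (1 - exp (-(s * h))) / h) (𝓝[>] 0) (𝓝 s) := by
  have hd : HasDerivAt (fun h : ℝ => 1 - exp (-(s * h))) s 0 := by
    refine ((((hasDerivAt_id (0 : ℝ)).const_mul s).neg.exp).const_sub 1).congr_deriv ?_
    simp
  refine (hd.tendsto_slope_zero_right).congr fun h => ?_
  simp [div_eq_inv_mul]

theorem tendsto_rpow_mul_exp_mul {ρ : ℝ} (h1 : 1 < ρ) {s : ℝ} (hs : 0 ≤ s) :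
    Tendsto (fun h : ℝ => h ^ (-ρ) * (exp (s * h) * (1 - exp (-(s * h))) ^ ρ))
      (𝓝[>] 0) (𝓝 (s ^ ρ)) := by
  have h2 := (tendsto_one_sub_exp_neg_div s).rpow_const (p := ρ) (Or.inr (by linarith))
  have h3 : Tendsto (fun h : ℝ => exp (s * h)) (𝓝[>] 0) (𝓝 1) := by
    have : Continuous fun h : ℝ => exp (s * h) := by fun_prop
    simpa using (this.tendsto 0).mono_left nhdsWithin_le_nhds
  have h4 := h3.mul h2
  rw [one_mul] at h4
  refine h4.congr' ?_
  filter_upwards [self_mem_nhdsWithin] with h hh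
  have hh : 0 < h := hh
  have : 0 ≤ 1 - exp (-(s * h)) := by
    rw [sub_nonneg, Real.exp_le_one_iff]
    have : 0 ≤ s * h := by positivity
    linarith
  rw [Real.div_rpow this hh.le, Real.rpow_neg hh.le]
  ring

theorem summable_nat_mul_pow_div {c : ℕ → ℝ} (hc : ∀ n, 0 < c n)
    (hs : ∀ x : ℝ, Summable fun n => x ^ n / c n) {x : ℝ} (hx : 0 ≤ x) :
    Summable fun n : ℕ => n * x ^ n / c n := by
  refine (hs (2 * x)).of_nonneg_of_le (fun n => by have := hc n; positivity) fun n => ?_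
  have := hc n
  rw [mul_pow]
  gcongr
  exact_mod_cast Nat.lt_two_pow_self.le

theorem hasDerivAt_tsum_pow_div {c : ℕ → ℝ} (hc : ∀ n, 0 < c n)
    (hs : ∀ x : ℝ, Summable fun n => x ^ n / c n) (x : ℝ) :
    HasDerivAt (fun x => ∑' n, x ^ n / c n) (∑' n : ℕ, n * x ^ (n - 1) / c n) x := by
  have hR : 1 ≤ |x| + 1 := by linarith [abs_nonneg x]
  refine hasDerivAt_tsum_of_isPreconnected (t := Metric.ball 0 (|x| + 1)) (y₀ := 0)
    (g := fun n y => y ^ n / c n) (g' := fun n y => n * y ^ (n - 1) / c n)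
    (summable_nat_mul_pow_div hc hs (zero_le_one.trans hR)) Metric.isOpen_ball
    (convex_ball _ _).isPreconnected (fun n y _ => (hasDerivAt_pow n y).div_const (c n))
    (fun n y hy => ?_) (Metric.mem_ball_self (by linarith)) (hs 0) (by simp)
  have := hc n
  rw [mem_ball_zero_iff, Real.norm_eq_abs] at hy
  rw [norm_div, norm_mul, norm_pow, Real.norm_eq_abs, Real.norm_eq_abs, Real.norm_eq_abs,
    abs_of_pos this, Nat.abs_cast]
  have h3 : |y| ^ (n - 1) ≤ (|x| + 1) ^ n :=
    (pow_le_pow_left₀ (abs_nonneg y) hy.le _).trans (pow_le_pow_right₀ hR (Nat.sub_le n 1))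
  gcongr

section Discretisation

variable {c : ℕ → ℝ} {d : ℕ → ℕ → ℝ} {t : ℕ → ℝ}

theorem tendsto_tsum_pow_div (hc : ∀ n, 0 < c n)
    (hs : ∀ x : ℝ, Summable fun n => x ^ n / c n) (hd : ∀ m n, c n ≤ d m n)
    (hdt : ∀ n, Tendsto (fun m => d m n) atTop (𝓝 (c n))) {q : ℝ} (hq : 0 ≤ q) :
    Tendsto (fun m => ∑' n, q ^ n / d m n) atTop (𝓝 (∑' n, q ^ n / c n)) := by
  refine tendsto_tsum_of_dominated_convergence (hs q)
    (fun n => (tendsto_const_nhds (x := q ^ n)).div (hdt n) (hc n).ne')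
    (Eventually.of_forall fun m n => ?_)
  have h1 := hc n
  have h2 := hd m n
  have h3 := h1.trans_le h2
  rw [Real.norm_of_nonneg (by positivity)]
  gcongr

theorem summable_pow_div_of_le (hc : ∀ n, 0 < c n)
    (hs : ∀ x : ℝ, Summable fun n => x ^ n / c n) {d : ℕ → ℝ} (hd : ∀ n, c n ≤ d n) (x : ℝ) :
    Summable fun n => x ^ n / d n := by
  refine (hs |x|).of_norm_bounded fun n => ?_
  have h1 := hc n
  have h2 := hd n
  rw [norm_div, norm_pow, Real.norm_eq_abs, Real.norm_eq_abs, abs_of_pos (h1.trans_le h2)]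
  gcongr

theorem tendsto_difference_quotient_tsum_pow_div (hc : ∀ n, 0 < c n)
    (hs : ∀ x : ℝ, Summable fun n => x ^ n / c n) (hd : ∀ m n, c n ≤ d m n)
    (hdt : ∀ n, Tendsto (fun m => d m n) atTop (𝓝 (c n))) (ht : ∀ m, 0 < t m)
    (ht0 : Tendsto t atTop (𝓝 0)) {q : ℝ} (hq : 0 < q) :
    Tendsto (fun m => (∑' n, q ^ n / d m n - ∑' n, (exp (-t m) * q) ^ n / d m n) / (t m * q)) atTop
      (𝓝 (∑' n : ℕ, n * q ^ (n - 1) / c n)) := by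
  have ht' : Tendsto t atTop (𝓝[>] 0) :=
    tendsto_nhdsWithin_iff.2 ⟨ht0, Eventually.of_forall ht⟩
  have hlim : Tendsto (fun m => ∑' n : ℕ, q ^ n / d m n * ((1 - exp (-(n * t m))) / t m)) atTop
      (𝓝 (∑' n : ℕ, q ^ n / c n * n)) := by
    refine tendsto_tsum_of_dominated_convergence (summable_nat_mul_pow_div hc hs hq.le)
      (fun n => ((tendsto_const_nhds (x := q ^ n)).div (hdt n) (hc n).ne').mul
        ((tendsto_one_sub_exp_neg_div n).comp ht')) (Eventually.of_forall fun m n => ?_)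
    have h1 := hc n
    have h2 := hd m n
    have h3 := h1.trans_le h2
    have h4 := ht m
    have h5 : 0 ≤ 1 - exp (-(n * t m)) := by
      rw [sub_nonneg, Real.exp_le_one_iff]
      have : 0 ≤ n * t m := by positivity
      linarith
    have h6 : (1 - exp (-(n * t m))) / t m ≤ n := by
      rw [div_le_iff₀ h4]
      linarith [Real.add_one_le_exp (-(n * t m))]
    rw [Real.norm_of_nonneg (by positivity)]
    calc q ^ n / d m n * ((1 - exp (-(n * t m))) / t m) ≤ q ^ n / c n * n := by gcongr
      _ = _ := by ring
  have hlim' := hlim.div_const q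
  rw [← tsum_div_const] at hlim'
  have he : ∑' n : ℕ, n * q ^ (n - 1) / c n = ∑' n : ℕ, q ^ n / c n * n / q := by
    refine tsum_congr fun n => ?_
    rcases n with _ | n
    · simp
    · rw [Nat.add_sub_cancel, pow_succ]
      field_simp
  rw [he]
  refine hlim'.congr fun m => ?_
  have h4 := ht m
  rw [← (summable_pow_div_of_le hc hs (hd m) q).tsum_sub
    (summable_pow_div_of_le hc hs (hd m) (exp (-t m) * q)), ← tsum_div_const, ← tsum_div_const]
  refine tsum_congr fun n => ?_
  rw [mul_pow, ← Real.exp_nat_mul, mul_neg]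
  field_simp

end Discretisation

/-- The grid analogue `e^s (1 - e^{-s})^ρ` of `s^ρ`. -/
noncomputable def gridPow (ρ s : ℝ) : ℝ :=
  exp s * (1 - exp (-s)) ^ ρ

/-- The analogue of `genFactorial` on a grid of mesh `h`. -/
noncomputable def gridFactorial (α γ ρ h : ℝ) (n : ℕ) : ℝ :=
  ∏ k ∈ Finset.range n,
    h ^ (-ρ) * (gridPow ρ (((k + 1 : ℕ) * α + γ) * h) - gridPow ρ (γ * h))

theorem exists_gridPow_eq {ρ : ℝ} (h1 : 1 < ρ) (h2 : ρ < 2) :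
    ∃ c : ℕ → ℝ, (∀ k, 0 ≤ c k) ∧ Summable c ∧
      ∀ s, 0 ≤ s → gridPow ρ s = exp s - ρ + ∑' k, c k * exp (-s) ^ (k + 1) := by
  obtain ⟨c, hc, hcs, h⟩ := exists_hasSum_one_sub_rpow h1 h2
  refine ⟨c, hc, hcs, fun s hs => ?_⟩
  have hee : exp s * exp (-s) = 1 := by rw [← Real.exp_add]; simp
  have ht : exp s * ∑' k, c k * exp (-s) ^ (k + 2) = ∑' k, c k * exp (-s) ^ (k + 1) := by
    rw [← tsum_mul_left]
    refine tsum_congr fun k => ?_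
    rw [pow_succ _ (k + 1)]
    linear_combination c k * exp (-s) ^ (k + 1) * hee
  rw [gridPow, h _ ⟨(Real.exp_pos _).le, Real.exp_le_one_iff.2 (by linarith)⟩, ← ht]
  linear_combination -ρ * hee

section StableSeries

variable {α γ ρ : ℝ}

theorem pow_mul_factorial_le_genFactorial (h1 : 1 < ρ) (hα : 0 < α) (hγ : 0 ≤ γ) (n : ℕ) :
    (α ^ ρ) ^ n * n.factorial ≤ genFactorial α γ ρ n := by
  have hprod : (α ^ ρ) ^ n * n.factorial = ∏ k ∈ Finset.range n, α ^ ρ * ((k + 1 : ℕ) : ℝ) := by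
    rw [Finset.prod_mul_distrib, Finset.prod_const, Finset.card_range,
      ← Finset.prod_range_add_one_eq_factorial, Nat.cast_prod]
  rw [hprod, genFactorial]
  refine Finset.prod_le_prod (fun k _ => by positivity) fun k _ => ?_
  have hk : 1 ≤ ((k + 1 : ℕ) : ℝ) := by simp
  have h3 : ((k + 1 : ℕ) * α) ^ ρ + γ ^ ρ ≤ ((k + 1 : ℕ) * α + γ) ^ ρ :=
    Real.add_rpow_le_rpow_add (by positivity) hγ h1.le
  have h4 : ((k + 1 : ℕ) : ℝ) ≤ ((k + 1 : ℕ) : ℝ) ^ ρ := Real.self_le_rpow_of_one_le hk h1.le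
  rw [Real.mul_rpow (by positivity) hα.le] at h3
  have : 0 < α ^ ρ := by positivity
  nlinarith

theorem genFactorial_pos (h1 : 1 < ρ) (hα : 0 < α) (hγ : 0 ≤ γ) (n : ℕ) :
    0 < genFactorial α γ ρ n :=
  lt_of_lt_of_le (by positivity) (pow_mul_factorial_le_genFactorial h1 hα hγ n)

theorem summable_pow_div_genFactorial (h1 : 1 < ρ) (hα : 0 < α) (hγ : 0 ≤ γ) (x : ℝ) :
    Summable fun n => x ^ n / genFactorial α γ ρ n := by
  have hA : 0 < α ^ ρ := by positivity
  refine (Real.summable_pow_div_factorial (|x| / α ^ ρ)).of_norm_bounded fun n => ?_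
  rw [norm_div, norm_pow, Real.norm_eq_abs, Real.norm_eq_abs,
    abs_of_pos (genFactorial_pos h1 hα hγ n), div_pow, div_div]
  gcongr
  exact pow_mul_factorial_le_genFactorial h1 hα hγ n

theorem genFactorial_le_gridFactorial (h1 : 1 < ρ) (h2 : ρ < 2) (hα : 0 < α) (hγ : 0 ≤ γ)
    {h : ℝ} (hh : 0 < h) (n : ℕ) : genFactorial α γ ρ n ≤ gridFactorial α γ ρ h n := by
  refine Finset.prod_le_prod (fun k _ => ?_) fun k _ => ?_
  · rw [sub_nonneg]
    refine Real.rpow_le_rpow hγ ?_ (by linarith)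
    have : 0 ≤ ((k + 1 : ℕ) : ℝ) * α := by positivity
    linarith
  · have hle : γ * h ≤ ((k + 1 : ℕ) * α + γ) * h := by
      have : 0 ≤ ((k + 1 : ℕ) : ℝ) * α := by positivity
      gcongr
      linarith
    have := rpow_sub_rpow_le_exp_mul h1 h2 (by positivity) hle
    rw [Real.mul_rpow (by positivity) hh.le, Real.mul_rpow hγ hh.le] at this
    rw [Real.rpow_neg hh.le, ← div_eq_inv_mul, le_div_iff₀ (by positivity), sub_mul]
    exact this

theorem tendsto_gridFactorial (h1 : 1 < ρ) (hα : 0 < α) (hγ : 0 ≤ γ) (n : ℕ) :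
    Tendsto (fun h => gridFactorial α γ ρ h n) (𝓝[>] 0) (𝓝 (genFactorial α γ ρ n)) := by
  refine tendsto_finsetProd _ fun k _ => ?_
  have h2 := (tendsto_rpow_mul_exp_mul h1 (by positivity : 0 ≤ ((k + 1 : ℕ) : ℝ) * α + γ)).sub
    (tendsto_rpow_mul_exp_mul h1 hγ)
  refine h2.congr fun h => ?_
  rw [gridPow, gridPow]
  ring

theorem gridFactorial_succ {c : ℕ → ℝ} (hc : ∀ k, 0 ≤ c k) (hcs : Summable c)
    (hF : ∀ s, 0 ≤ s → gridPow ρ s = exp s - ρ + ∑' k, c k * exp (-s) ^ (k + 1))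
    (hα : 0 < α) (hγ : 0 ≤ γ) {h : ℝ} (hh : 0 < h) (n : ℕ) :
    gridFactorial α γ ρ h (n + 1) =
      (h ^ (-ρ) * exp (γ * h) * ((exp (-(α * h)) ^ (n + 1))⁻¹ - 1) -
        ∑' k, h ^ (-ρ) * (c k * exp (-(γ * h)) ^ (k + 1)) *
          (1 - (exp (-(α * h)) ^ (k + 1)) ^ (n + 1))) * gridFactorial α γ ρ h n := by
  have hsum : ∀ s, 0 ≤ s → Summable fun k => c k * exp (-s) ^ (k + 1) := fun s hs => by
    refine hcs.of_nonneg_of_le (fun k => mul_nonneg (hc k) (by positivity)) fun k =>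
      mul_le_of_le_one_right (hc k) (pow_le_one₀ (Real.exp_pos _).le ?_)
    exact Real.exp_le_one_iff.2 (by linarith)
  rw [gridFactorial, Finset.prod_range_succ, ← gridFactorial, mul_comm]
  congr 1
  rw [hF _ (by positivity), hF _ (by positivity)]
  have h3 : ∑' k, h ^ (-ρ) * (c k * exp (-(γ * h)) ^ (k + 1)) *
      (1 - (exp (-(α * h)) ^ (k + 1)) ^ (n + 1)) =
      h ^ (-ρ) * (∑' k, c k * exp (-(γ * h)) ^ (k + 1) -
        ∑' k, c k * exp (-(((n + 1 : ℕ) * α + γ) * h)) ^ (k + 1)) := by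
    rw [← (hsum _ (by positivity)).tsum_sub (hsum _ (by positivity)), ← tsum_mul_left]
    refine tsum_congr fun k => ?_
    have : exp (-(((n + 1 : ℕ) * α + γ) * h)) = exp (-(α * h)) ^ (n + 1) * exp (-(γ * h)) := by
      rw [← Real.exp_nat_mul, ← Real.exp_add]
      congr 1
      ring
    rw [this, mul_pow, ← pow_mul, ← pow_mul, mul_comm (n + 1)]
    ring
  have h4 : exp (((n + 1 : ℕ) * α + γ) * h) = exp (γ * h) * (exp (-(α * h)) ^ (n + 1))⁻¹ := by
    rw [← Real.exp_nat_mul, ← Real.exp_neg, ← Real.exp_add]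
    congr 1
    ring
  rw [h3, h4]
  ring

theorem exists_isLaplaceTransform_approx_gridFactorial (h1 : 1 < ρ) (h2 : ρ < 2) (hα : 0 < α)
    (hγ : 0 ≤ γ) {h M ε : ℝ} (hh : 0 < h) (hM : 0 ≤ M) (hε : 0 < ε) :
    ∃ G, IsLaplaceTransform G ∧ G 0 = 1 ∧ ∀ x ∈ Icc 0 M,
      |G x - (∑' n, (exp (-(α * h)) * x) ^ n / gridFactorial α γ ρ h n) /
        ∑' n, x ^ n / gridFactorial α γ ρ h n| ≤ ε * x := by
  obtain ⟨c, hc, hcs, hF⟩ := exists_gridPow_eq h1 h2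
  have hg := genFactorial_pos (ρ := ρ) h1 hα hγ
  have hle := genFactorial_le_gridFactorial h1 h2 hα hγ hh
  refine exists_isLaplaceTransform_approx (w := h ^ (-ρ) * exp (γ * h))
    (p := fun k => h ^ (-ρ) * (c k * exp (-(γ * h)) ^ (k + 1))) (by positivity)
    (Real.exp_pos _) ?_ (fun k => ?_) ?_ (fun n => (hg n).trans_le (hle n))
    (by simp [gridFactorial])
    (summable_pow_div_of_le hg (summable_pow_div_genFactorial h1 hα hγ) hle)
    (gridFactorial_succ hc hcs hF hα hγ hh) hM hε
  · rw [Real.exp_lt_one_iff]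
    have : 0 < α * h := by positivity
    linarith
  · have := hc k
    positivity
  · refine Summable.mul_left _ (hcs.of_nonneg_of_le (fun k => ?_) fun k => ?_)
    · have := hc k
      positivity
    · refine mul_le_of_le_one_right (hc k) (pow_le_one₀ (Real.exp_pos _).le ?_)
      rw [Real.exp_le_one_iff]
      have : 0 ≤ γ * h := by positivity
      linarith

theorem IstableSer_zero : IstableSer α γ ρ 0 = 1 := by
  rw [IstableSer, tsum_eq_single 0 fun n hn => by simp [hn]]
  simp [genFactorial]

theorem IstableSer_pos (h1 : 1 < ρ) (hα : 0 < α) (hγ : 0 ≤ γ) {x : ℝ} (hx : 0 ≤ x) :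
    0 < IstableSer α γ ρ x := by
  have hg := genFactorial_pos (ρ := ρ) h1 hα hγ
  refine (summable_pow_div_genFactorial h1 hα hγ x).tsum_pos
    (fun n => div_nonneg (by positivity) (hg n).le) 0 ?_
  simp [genFactorial]

theorem exists_laplace_representation_logDeriv_IstableSer (h1 : 1 < ρ) (h2 : ρ < 2) (hα : 0 < α)
    (hγ : 0 ≤ γ) :
    ∃ a, 0 ≤ a ∧ ∃ k : ℝ → ℝ, (∀ r, 0 < r → 0 ≤ k r) ∧ AntitoneOn k (Ioi 0) ∧
      ∀ q, 0 < q → IntegrableOn (fun r => exp (-(q * r)) * k r) (Ioi 0) ∧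
        (∑' n : ℕ, n * q ^ (n - 1) / genFactorial α γ ρ n) / IstableSer α γ ρ q =
          a + ∫ r in Ioi 0, exp (-(q * r)) * k r := by
  have hg := genFactorial_pos (ρ := ρ) h1 hα hγ
  have hgs := summable_pow_div_genFactorial (ρ := ρ) h1 hα hγ
  set h : ℕ → ℝ := fun m => 1 / ((m : ℝ) + 1) with hh
  have hpos : ∀ m, 0 < h m := fun m => by rw [hh]; positivity
  have hlim : Tendsto h atTop (𝓝 0) := tendsto_one_div_add_atTop_nhds_zero_nat
  have hlim' : Tendsto h atTop (𝓝[>] 0) :=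
    tendsto_nhdsWithin_iff.2 ⟨hlim, Eventually.of_forall hpos⟩
  choose G hG hG0 hGa using fun m : ℕ => exists_isLaplaceTransform_approx_gridFactorial h1 h2 hα hγ
    (hpos m) (by positivity : (0 : ℝ) ≤ m) (pow_pos (hpos m) 2)
  have hle : ∀ m n, genFactorial α γ ρ n ≤ gridFactorial α γ ρ (h m) n := fun m =>
    genFactorial_le_gridFactorial h1 h2 hα hγ (hpos m)
  have htend : ∀ n, Tendsto (fun m => gridFactorial α γ ρ (h m) n) atTop
      (𝓝 (genFactorial α γ ρ n)) := fun n => (tendsto_gridFactorial h1 hα hγ n).comp hlim'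
  refine exists_laplace_representation_of_tendsto hG hG0 (fun m => mul_pos hα (hpos m))
    fun q hq => ?_
  have hJ := tendsto_tsum_pow_div hg hgs hle htend hq.le
  have hJ' := tendsto_difference_quotient_tsum_pow_div hg hgs hle htend
    (fun m => mul_pos hα (hpos m)) (by simpa using hlim.const_mul α) hq
  have hquot := hJ'.div hJ (IstableSer_pos h1 hα hγ hq.le).ne'
  have herr : Tendsto (fun m => h m / α) atTop (𝓝 0) := by simpa using hlim.div_const α
  refine hquot.congr_dist (squeeze_zero' (Eventually.of_forall fun _ => dist_nonneg) ?_ herr)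
  filter_upwards [eventually_ge_atTop ⌈q⌉₊] with m hm
  have hqm : q ≤ m := (Nat.le_ceil q).trans (by exact_mod_cast hm)
  have hbound := hGa m q ⟨hq.le, hqm⟩
  have hm0 := hpos m
  have hS : 0 < ∑' n, q ^ n / gridFactorial α γ ρ (h m) n := by
    refine (summable_pow_div_of_le hg hgs (hle m) q).tsum_pos (fun n =>
      div_nonneg (by positivity) ((hg n).le.trans (hle m n))) 0 ?_
    simp [gridFactorial]
  rw [Pi.div_apply, Real.dist_eq]
  have heq : (∑' n, q ^ n / gridFactorial α γ ρ (h m) n -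
      ∑' n, (exp (-(α * h m)) * q) ^ n / gridFactorial α γ ρ (h m) n) / (α * h m * q) /
        ∑' n, q ^ n / gridFactorial α γ ρ (h m) n - (1 - G m q) / (α * h m * q) =
      (G m q - (∑' n, (exp (-(α * h m)) * q) ^ n / gridFactorial α γ ρ (h m) n) /
        ∑' n, q ^ n / gridFactorial α γ ρ (h m) n) / (α * h m * q) := by
    field_simp
    ring
  rw [heq, abs_div, abs_of_pos (by positivity : 0 < α * h m * q), div_le_iff₀ (by positivity)]
  refine hbound.trans_eq ?_
  field_simp

end StableSeries

end LaplaceTransforms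

/-- Corollary of Section 4.3: for `1 < ρ < 2`, `α > 0` and `γ ≥ 0`, `q ↦ 1/I_{α,γ,ρ}(q)` is
the Laplace transform of a self-decomposable probability distribution on `[0,∞)`. -/
theorem IstableSer_inv_self_decomposable (ρ α γ : ℝ)
    (hρ1 : 1 < ρ) (hρ2 : ρ < 2) (hα : 0 < α) (hγ : 0 ≤ γ) :
    ∃ a : ℝ, 0 ≤ a ∧ ∃ k : ℝ → ℝ,
      (∀ r : ℝ, 0 < r → 0 ≤ k r) ∧ AntitoneOn k (Ioi 0) ∧
      IntegrableOn (fun r => min 1 r * (k r / r)) (Ioi 0) volume ∧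
      ∀ q : ℝ, 0 ≤ q →
        1 / IstableSer α γ ρ q =
          Real.exp (-(a * q + ∫ r in Ioi (0 : ℝ), (1 - Real.exp (-q * r)) * (k r / r))) := by
  obtain ⟨a, ha, k, hk0, hk, hrep⟩ :=
    exists_laplace_representation_logDeriv_IstableSer hρ1 hρ2 hα hγ
  have hJpos : ∀ x, 0 ≤ x → 0 < IstableSer α γ ρ x := fun x hx => IstableSer_pos hρ1 hα hγ hx
  have hmain := fun {q : ℝ} (hq : 0 < q) => integral_laplace_representation
    (J := IstableSer α γ ρ) ha IstableSer_zero hJpos (fun x _ => hasDerivAt_tsum_pow_div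
      (genFactorial_pos hρ1 hα hγ) (summable_pow_div_genFactorial hρ1 hα hγ) x) hk0 hk hrep hq
  refine ⟨a, ha, k, hk0, hk, integrableOn_min_one_mul hk0 hk (hmain one_pos).1, fun q hq => ?_⟩
  rcases hq.eq_or_lt with rfl | hq
  · simp [IstableSer_zero]
  · rw [← (hmain hq).2, Real.exp_neg, Real.exp_log (hJpos q hq.le), one_div]
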